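/- Let d ≥ 2 and r > d, and let m*^0 denote the solution of the linear equation ṁ_s = −2γ_s m_s + 2b_s², m(−T) = 0, given explicitly by m*^0_s(τ) = (b(s)²/γ_s)(1 − e^{−2γ_s(τ+T)}). There exist ε_* > 0 and C > 0, independent of ε and T, such that for every ε ∈ [0, ε_*] and every T ∈ (0,∞) the solution m* of the damped/driven wave kinetic equation with zero data at τ = −T satisfies sup_{τ≥−T} ‖m*(τ) − m*^0(τ)‖_r ≤ C ε. -/

import Mathlib

open MeasureTheory

noncomputable section

/-- `ℝ^d` with its Euclidean structure. -/
abbrev Rd (d : ℕ) := EuclideanSpace ℝ (Fin d)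

/-- Integral of `f` over the hyperplane `x^⊥ = {z : x·z = 0}` with respect to the
`(d-1)`-dimensional Lebesgue measure induced by the Euclidean inner product. -/
noncomputable def hyperplaneIntegral (d : ℕ) (x : Rd d) (f : Rd d → ℝ) : ℝ :=
  ∫ z : ((ℝ ∙ x)ᗮ : Submodule ℝ (Rd d)), f (z : Rd d)

/-- The weighted sup-norm `‖y‖_r = sup_s (1+|s|)^r |y(s)|`. -/
noncomputable def wNorm (d : ℕ) (r : ℝ) (y : Rd d → ℝ) : ℝ :=
  ⨆ s : Rd d, (1 + ‖s‖) ^ r * |y s|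

/-- Membership in the space `C_r(ℝ^d)` of continuous functions with finite `‖·‖_r`. -/
def memCr (d : ℕ) (r : ℝ) (y : Rd d → ℝ) : Prop :=
  Continuous y ∧ ∃ K : ℝ, ∀ s : Rd d, (1 + ‖s‖) ^ r * |y s| ≤ K

/-- The integrand of the wave kinetic integral. -/
noncomputable def kinIntegrand (d : ℕ) (y : Rd d → ℝ) (s x z : Rd d) : ℝ :=
  y (s + x) * y (s + z) * y (s + x + z) + y (s + x) * y (s + z) * y s
    - y (s + z) * y (s + x + z) * y s - y (s + x) * y (s + x + z) * y s

/-- The wave kinetic integral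
`K_s(y) = 2π ∫_{ℝ^d} |x|⁻¹ (∫_{x^⊥} [...] dz) dx`. -/
noncomputable def Kwk (d : ℕ) (y : Rd d → ℝ) (s : Rd d) : ℝ :=
  2 * Real.pi * ∫ x : Rd d, ‖x‖⁻¹ * hyperplaneIntegral d x (kinIntegrand d y s x)

/-- `γ_s = (1+|s|²)^{r_*}`. -/
noncomputable def gam (d : ℕ) (rstar : ℝ) (s : Rd d) : ℝ := (1 + ‖s‖ ^ 2) ^ rstar

/-- A (bounded continuous, mild-form) solution of the damped/driven wave kinetic equation
`ṁ_s = −2γ_s m_s + 2 b_s² + ε K_s(m)` with zero data at `τ = −T`: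
a curve `m : [−T,∞) → C_r(ℝ^d)` which is bounded, continuous in the `‖·‖_r`-norm, and
satisfies `m_s(τ) = ∫_{−T}^τ e^{−2γ_s(τ−l)} (2 b(s)² + ε K_s(m(l))) dl`. -/
def IsWKESol (d : ℕ) (r rstar : ℝ) (b : Rd d → ℝ) (T ε : ℝ)
    (m : ℝ → Rd d → ℝ) : Prop :=
  (∀ τ ∈ Set.Ici (-T), memCr d r (m τ)) ∧
  (∃ K : ℝ, ∀ τ ∈ Set.Ici (-T), wNorm d r (m τ) ≤ K) ∧
  (∀ τ₀ ∈ Set.Ici (-T), ∀ δ : ℝ, 0 < δ → ∃ η : ℝ, 0 < η ∧ ∀ τ ∈ Set.Ici (-T),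
      |τ - τ₀| < η → wNorm d r (fun s => m τ s - m τ₀ s) < δ) ∧
  (∀ τ ∈ Set.Ici (-T), ∀ s : Rd d,
      m τ s = ∫ l in Set.Icc (-T) τ,
        Real.exp (-2 * gam d rstar s * (τ - l)) * (2 * (b s) ^ 2 + ε * Kwk d (m l) s))

/-- The explicit solution `m*⁰_s(τ) = (b(s)²/γ_s)(1 − e^{−2γ_s(τ+T)})` of the linear equation
`ṁ_s = −2γ_s m_s + 2b_s²`, `m(−T) = 0`. -/
noncomputable def linSol (d : ℕ) (rstar : ℝ) (b : Rd d → ℝ) (T τ : ℝ) (s : Rd d) : ℝ :=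
  (b s) ^ 2 / gam d rstar s * (1 - Real.exp (-2 * gam d rstar s * (τ + T)))

/-- The weight `(1 + ‖s‖)^{-r}`. -/
def decay {E : Type*} [Norm E] (r : ℝ) (s : E) : ℝ := (1 + ‖s‖) ^ (-r)

section Decay

variable {E : Type*} [NormedAddCommGroup E] {r : ℝ}

lemma decay_pos (r : ℝ) (s : E) : 0 < decay r s := by
  unfold decay; positivity

lemma decay_nonneg (r : ℝ) (s : E) : 0 ≤ decay r s := (decay_pos r s).le

lemma decay_mul_weight (r : ℝ) (s : E) : decay r s * (1 + ‖s‖) ^ r = 1 := by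
  unfold decay
  rw [← Real.rpow_add (by positivity)]; simp

lemma weight_mul_decay (r : ℝ) (s : E) : (1 + ‖s‖) ^ r * decay r s = 1 := by
  rw [mul_comm, decay_mul_weight]

lemma abs_le_mul_decay_iff {y : ℝ} {s : E} {M : ℝ} :
    |y| ≤ M * decay r s ↔ (1 + ‖s‖) ^ r * |y| ≤ M := by
  have h : decay r s = ((1 + ‖s‖) ^ r)⁻¹ := Real.rpow_neg (by positivity) r
  rw [h, ← div_eq_mul_inv, le_div_iff₀ (by positivity), mul_comm]

lemma decay_le_one (hr : 0 ≤ r) (s : E) : decay r s ≤ 1 :=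
  Real.rpow_le_one_of_one_le_of_nonpos (by linarith [norm_nonneg s]) (by linarith)

lemma decay_anti {F : Type*} [NormedAddCommGroup F] (hr : 0 ≤ r) {s : E} {t : F}
    (h : ‖s‖ ≤ ‖t‖) : decay r t ≤ decay r s :=
  Real.rpow_le_rpow_of_nonpos (by positivity) (by linarith) (by linarith)

lemma continuous_decay (r : ℝ) : Continuous (decay r : E → ℝ) :=
  (continuous_const.add continuous_norm).rpow_const
    fun s => Or.inl (by positivity : (1 + ‖s‖) ≠ 0)

lemma decay_le_of_one_add_norm_le {s t : E} (hr : 0 ≤ r) (h : 1 + ‖s‖ ≤ 2 * (1 + ‖t‖)) :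
    decay r t ≤ 2 ^ r * decay r s := by
  have h1 : (2 * (1 + ‖t‖)) ^ (-r) ≤ (1 + ‖s‖) ^ (-r) :=
    Real.rpow_le_rpow_of_nonpos (by positivity) h (by linarith)
  rw [Real.mul_rpow (by norm_num) (by positivity)] at h1
  have h2 : (2 : ℝ) ^ r * 2 ^ (-r) = 1 := by rw [← Real.rpow_add (by norm_num)]; simp
  calc decay r t = 2 ^ r * (2 ^ (-r) * (1 + ‖t‖) ^ (-r)) := by rw [← mul_assoc, h2, one_mul]; rfl
    _ ≤ _ := by unfold decay; gcongr

lemma decay_le_of_norm_sub_le {s t : E} (hr : 0 ≤ r) (h : ‖s - t‖ ≤ 1) :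
    decay r t ≤ 2 ^ r * decay r s := by
  refine decay_le_of_one_add_norm_le hr ?_
  have := norm_sub_norm_le s t
  linarith [norm_nonneg t]

lemma decay_mul_decay_le {a b c : E} (hr : 0 ≤ r) (h : ‖a‖ ≤ ‖b‖ + ‖c‖) :
    decay r b * decay r c ≤ 2 ^ r * decay r a * (decay r b + decay r c) := by
  have hb := decay_pos r b
  have hc := decay_pos r c
  have ha : 0 < 2 ^ r * decay r a := mul_pos (by positivity) (decay_pos r a)
  rcases le_total ‖b‖ ‖c‖ with hbc | hbc
  · have : decay r c ≤ 2 ^ r * decay r a := decay_le_of_one_add_norm_le hr (by linarith)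
    nlinarith
  · have : decay r b ≤ 2 ^ r * decay r a := decay_le_of_one_add_norm_le hr (by linarith)
    nlinarith

end Decay

lemma abs_mul_mul_sub_le {M δ a₁ a₂ a₃ b₁ b₂ b₃ p₁ p₂ p₃ : ℝ}
    (hp₁ : 0 ≤ p₁) (hp₂ : 0 ≤ p₂) (hM : 0 ≤ M) (hδ : 0 ≤ δ)
    (ha₂ : |a₂| ≤ M * p₂) (ha₃ : |a₃| ≤ M * p₃)
    (hb₁ : |b₁| ≤ M * p₁) (hb₂ : |b₂| ≤ M * p₂)
    (h₁ : |a₁ - b₁| ≤ δ * p₁) (h₂ : |a₂ - b₂| ≤ δ * p₂) (h₃ : |a₃ - b₃| ≤ δ * p₃) :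
    |a₁ * a₂ * a₃ - b₁ * b₂ * b₃| ≤ 3 * M ^ 2 * δ * (p₁ * p₂ * p₃) := by
  have e : a₁ * a₂ * a₃ - b₁ * b₂ * b₃ =
    (a₁ - b₁) * a₂ * a₃ + b₁ * (a₂ - b₂) * a₃ + b₁ * b₂ * (a₃ - b₃) := by ring
  rw [e]
  have t₁ : |(a₁ - b₁) * a₂ * a₃| ≤ δ * p₁ * (M * p₂) * (M * p₃) := by
    rw [abs_mul, abs_mul]; gcongr
  have t₂ : |b₁ * (a₂ - b₂) * a₃| ≤ M * p₁ * (δ * p₂) * (M * p₃) := by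
    rw [abs_mul, abs_mul]; gcongr
  have t₃ : |b₁ * b₂ * (a₃ - b₃)| ≤ M * p₁ * (M * p₂) * (δ * p₃) := by
    rw [abs_mul, abs_mul]; gcongr
  refine (abs_add_le _ _).trans ?_
  refine (add_le_add (abs_add_le _ _) le_rfl).trans ?_
  linarith

lemma norm_le_add_of_inner_eq_zero {E : Type*} [NormedAddCommGroup E] [InnerProductSpace ℝ E]
    {s x z : E} (h : inner ℝ x z = 0) : ‖s‖ ≤ ‖s + x‖ + ‖s + z‖ := by
  have h1 : ‖s‖ ^ 2 + ‖s + x + z‖ ^ 2 = ‖s + x‖ ^ 2 + ‖s + z‖ ^ 2 := by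
    simp only [norm_add_sq_real, inner_add_left, h]; ring
  nlinarith [norm_nonneg s, norm_nonneg (s + x), norm_nonneg (s + z), sq_nonneg ‖s + x + z‖]

/-- The majorant of the kinetic integrand at `s`, divided by the weight at `s`. -/
def kinMajorant (d : ℕ) (r : ℝ) (s x z : Rd d) : ℝ :=
  (decay r (s + x) + 2 ^ r * decay r x) * (decay r (s + z) + decay r (s + x + z))

lemma kinMajorant_nonneg (d : ℕ) (r : ℝ) (s x z : Rd d) : 0 ≤ kinMajorant d r s x z := by
  have := fun v : Rd d => decay_pos r v
  unfold kinMajorant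
  exact mul_nonneg (add_nonneg (this _).le (mul_nonneg (by positivity) (this _).le))
    (add_nonneg (this _).le (this _).le)

lemma abs_kinIntegrand_sub_le {d : ℕ} {r M δ : ℝ} (hr : 0 ≤ r) (hM : 0 ≤ M) (hδ : 0 ≤ δ)
    {y v : Rd d → ℝ} (hy : ∀ s, |y s| ≤ M * decay r s) (hv : ∀ s, |v s| ≤ M * decay r s)
    (hyv : ∀ s, |y s - v s| ≤ δ * decay r s) {s x z : Rd d} (hxz : inner ℝ x z = 0) :
    |kinIntegrand d y s x z - kinIntegrand d v s x z| ≤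
      3 * M ^ 2 * δ * ((2 ^ r + 1) * (decay r s * kinMajorant d r s x z)) := by
  have key (a b c : Rd d) : |y a * y b * y c - v a * v b * v c| ≤
      3 * M ^ 2 * δ * (decay r a * decay r b * decay r c) :=
    abs_mul_mul_sub_le (decay_nonneg _ _) (decay_nonneg _ _) hM hδ (hy _) (hy _) (hv _) (hv _)
      (hyv _) (hyv _) (hyv _)
  have k1 := key (s + x) (s + z) (s + x + z)
  have k2 := key (s + x) (s + z) s
  have k3 := key (s + z) (s + x + z) s
  have k4 := key (s + x) (s + x + z) s
  have c1 := decay_mul_decay_le hr (norm_le_add_of_inner_eq_zero (s := s) hxz)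
  have c2 : decay r (s + x + z) * decay r (s + z) ≤
      2 ^ r * decay r x * (decay r (s + x + z) + decay r (s + z)) := by
    refine decay_mul_decay_le hr ?_
    have : x = (s + x + z) - (s + z) := by abel
    exact (congrArg norm this).le.trans (norm_sub_le _ _)
  have hc : (0 : ℝ) < 2 ^ r := by positivity
  have p0 := decay_pos r s
  have p1 := decay_pos r (s + x)
  have p2 := decay_pos r (s + z)
  have p3 := decay_pos r (s + x + z)
  have px := decay_pos r x
  have main : decay r (s + x) * decay r (s + z) * decay r (s + x + z) +
      decay r (s + x) * decay r (s + z) * decay r s +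
      decay r (s + z) * decay r (s + x + z) * decay r s +
      decay r (s + x) * decay r (s + x + z) * decay r s ≤
      (2 ^ r + 1) * (decay r s * kinMajorant d r s x z) := by
    unfold kinMajorant
    generalize decay r s = q0 at *
    generalize decay r (s + x) = q1 at *
    generalize decay r (s + z) = q2 at *
    generalize decay r (s + x + z) = q3 at *
    generalize decay r x = qx at *
    generalize (2 : ℝ) ^ r = c at *
    have e1 : q1 * q2 * q3 ≤ c * q0 * (q1 + q2) * q3 := by gcongr
    have e2 : (c + 1) * q0 * (q3 * q2) ≤ (c + 1) * q0 * (c * qx * (q3 + q2)) := by gcongr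
    have e3 : 0 ≤ c * (q0 * (q1 * q2)) := by positivity
    linarith
  have h3 : 0 ≤ 3 * M ^ 2 * δ := by positivity
  refine le_trans ?_ (mul_le_mul_of_nonneg_left main h3)
  have e : kinIntegrand d y s x z - kinIntegrand d v s x z =
      (y (s + x) * y (s + z) * y (s + x + z) - v (s + x) * v (s + z) * v (s + x + z)) +
      (y (s + x) * y (s + z) * y s - v (s + x) * v (s + z) * v s) -
      (y (s + z) * y (s + x + z) * y s - v (s + z) * v (s + x + z) * v s) -
      (y (s + x) * y (s + x + z) * y s - v (s + x) * v (s + x + z) * v s) := by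
    unfold kinIntegrand; ring
  rw [e]
  refine (abs_sub _ _).trans ((add_le_add ((abs_sub _ _).trans
    (add_le_add (abs_add_le _ _) le_rfl)) le_rfl).trans ?_)
  linarith

section AxisReflection

variable {d : ℕ} {e : Rd d}

/-- The reflection exchanging `x` and `‖x‖ e`, for a unit vector `e`. -/
def axisReflection (e x : Rd d) : Rd d ≃ₗᵢ[ℝ] Rd d :=
  (ℝ ∙ (‖x‖ • e - x))ᗮ.reflection

lemma axisReflection_apply (e x z : Rd d) :
    axisReflection e x z =
      z - 2 • (inner ℝ (‖x‖ • e - x) z / ‖‖x‖ • e - x‖ ^ 2) • (‖x‖ • e - x) := by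
  unfold axisReflection
  rw [Submodule.reflection_orthogonal_apply, Submodule.reflection_singleton_apply]
  simp

lemma axisReflection_axisReflection (e x z : Rd d) :
    axisReflection e x (axisReflection e x z) = z :=
  Submodule.reflection_reflection _ z

lemma measurable_axisReflection (e : Rd d) :
    Measurable fun p : Rd d × (ℝ ∙ e)ᗮ => axisReflection e p.1 (p.2 : Rd d) := by
  simp only [axisReflection_apply]
  have h1 : Measurable fun p : Rd d × (ℝ ∙ e)ᗮ => ((p.2 : Rd d)) :=
    measurable_subtype_coe.comp measurable_snd
  have h2 : Measurable fun p : Rd d × (ℝ ∙ e)ᗮ => (‖p.1‖ • e - p.1) :=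
    (measurable_fst.norm.smul_const e).sub measurable_fst
  exact h1.sub ((((h2.inner h1).div (h2.norm.pow_const 2)).smul h2).const_smul 2)

lemma axisReflection_map_orthogonal (he : ‖e‖ = 1) {x : Rd d} (hx : x ≠ 0) :
    (ℝ ∙ e)ᗮ.map ((axisReflection e x).toLinearEquiv : Rd d →ₗ[ℝ] Rd d) = (ℝ ∙ x)ᗮ := by
  have hxn : ‖x‖ ≠ 0 := norm_ne_zero_iff.2 hx
  have h1 : axisReflection e x (‖x‖ • e) = x :=
    Submodule.reflection_sub (by rw [norm_smul, he]; simp)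
  have h2 : (ℝ ∙ e) = (ℝ ∙ (‖x‖ • e)) :=
    (Submodule.span_singleton_smul_eq (IsUnit.mk0 _ hxn) e).symm
  refine (Submodule.map_orthogonal_equiv _ _).trans ?_
  rw [h2, Submodule.map_span, Set.image_singleton]
  congr 3

lemma inner_axisReflection_eq_zero (he : ‖e‖ = 1) (x : Rd d) (w : (ℝ ∙ e)ᗮ) :
    inner ℝ x (axisReflection e x (w : Rd d)) = 0 := by
  by_cases hx : x = 0
  · simp [hx]
  · have : axisReflection e x (w : Rd d) ∈ (ℝ ∙ x)ᗮ := by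
      rw [← axisReflection_map_orthogonal he hx]
      exact Submodule.mem_map_of_mem w.2
    exact Submodule.mem_orthogonal_singleton_iff_inner_right.1 this

lemma integral_submodule_eq_of_map_eq {p q : Submodule ℝ (Rd d)} (A : Rd d ≃ₗᵢ[ℝ] Rd d)
    (h : p.map (A.toLinearEquiv : Rd d →ₗ[ℝ] Rd d) = q) (f : Rd d → ℝ) :
    ∫ z : q, f z = ∫ w : p, f (A w) := by
  subst h
  have := (LinearIsometryEquiv.submoduleMap p A).measurePreserving
  exact ((this.integral_comp
    (LinearIsometryEquiv.submoduleMap p A).toHomeomorph.measurableEmbedding) (fun z => f z)).symm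

lemma hyperplaneIntegral_eq (he : ‖e‖ = 1) {x : Rd d} (hx : x ≠ 0) (f : Rd d → ℝ) :
    hyperplaneIntegral d x f = ∫ w : (ℝ ∙ e)ᗮ, f (axisReflection e x w) :=
  integral_submodule_eq_of_map_eq _ (axisReflection_map_orthogonal he hx) f

lemma lintegral_decay_axisReflection_le {r : ℝ} (hr : 0 ≤ r) (e x a : Rd d) :
    ∫⁻ w : (ℝ ∙ e)ᗮ, ENNReal.ofReal (decay r (a + axisReflection e x w)) ≤
      ∫⁻ w : (ℝ ∙ e)ᗮ, ENNReal.ofReal (decay r w) := by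
  set p : (ℝ ∙ e)ᗮ := (ℝ ∙ e)ᗮ.orthogonalProjectionOnto (axisReflection e x a) with hp
  rw [← lintegral_add_left_eq_self (fun w : (ℝ ∙ e)ᗮ => ENNReal.ofReal (decay r w)) p]
  refine lintegral_mono fun w => ENNReal.ofReal_le_ofReal (decay_anti hr ?_)
  have h1 : p + w = (ℝ ∙ e)ᗮ.orthogonalProjectionOnto (axisReflection e x a + w) := by
    rw [map_add, Submodule.orthogonalProjectionOnto_mem_subspace_eq_self]
  have h2 : ‖a + axisReflection e x w‖ = ‖axisReflection e x a + w‖ := by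
    rw [← (axisReflection e x).norm_map (a + _), map_add, axisReflection_axisReflection]
  rw [h1, h2]
  exact Submodule.norm_orthogonalProjectionOnto_apply_le _ _

end AxisReflection

lemma integrable_decay {E : Type*} [NormedAddCommGroup E] [NormedSpace ℝ E]
    [FiniteDimensional ℝ E] [MeasurableSpace E] [BorelSpace E] {μ : Measure E}
    [μ.IsAddHaarMeasure] {r : ℝ} (hr : (Module.finrank ℝ E : ℝ) < r) :
    Integrable (decay r : E → ℝ) μ :=
  integrable_one_add_norm hr

lemma integrable_decay_orthogonal {d : ℕ} {r : ℝ} (hr : (d : ℝ) < r) (e : Rd d) :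
    Integrable (decay r : (ℝ ∙ e)ᗮ → ℝ) := by
  refine integrable_decay (lt_of_le_of_lt ?_ hr)
  have := Submodule.finrank_le (ℝ ∙ e)ᗮ
  rw [finrank_euclideanSpace_fin] at this
  exact_mod_cast this

lemma integrable_indicator_ball_inv_norm {d : ℕ} (hd : 2 ≤ d) :
    Integrable fun x : Rd d => (Set.Iio (1 : ℝ)).indicator (fun t => t⁻¹) ‖x‖ := by
  have : Nontrivial (Rd d) :=
    Module.nontrivial_of_finrank_pos (R := ℝ) (by rw [finrank_euclideanSpace_fin]; omega)
  rw [integrable_fun_norm_addHaar volume (f := (Set.Iio (1 : ℝ)).indicator fun t => t⁻¹),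
    finrank_euclideanSpace_fin]
  have h : IntegrableOn (fun _ : ℝ => (1 : ℝ)) (Set.Ioo 0 1) := by simp
  have h2 : Integrable ((Set.Ioo (0 : ℝ) 1).indicator fun _ => (1 : ℝ)) :=
    (integrable_indicator_iff measurableSet_Ioo).2 h
  refine Integrable.mono' h2.integrableOn ?_ ?_
  · refine Measurable.aestronglyMeasurable ?_
    exact (measurable_id.pow_const _).smul (measurable_inv.indicator measurableSet_Iio)
  · refine (ae_restrict_iff' measurableSet_Ioi).2 (.of_forall fun t (ht : 0 < t) => ?_)
    by_cases h1 : t < 1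
    · have e1 : t ∈ Set.Ioo (0 : ℝ) 1 := ⟨ht, h1⟩
      have e2 : t ∈ Set.Iio (1 : ℝ) := h1
      obtain ⟨k, rfl⟩ := Nat.exists_eq_add_of_le hd
      simp only [Set.indicator_of_mem e1, Set.indicator_of_mem e2]
      have : 2 + k - 1 = k + 1 := by omega
      rw [this, smul_eq_mul, pow_succ, mul_assoc, mul_inv_cancel₀ ht.ne', mul_one,
        Real.norm_of_nonneg (by positivity)]
      exact pow_le_one₀ ht.le h1.le
    · have e2 : t ∉ Set.Iio (1 : ℝ) := h1
      rw [Set.indicator_of_notMem e2]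
      simp only [smul_zero, norm_zero]
      exact Set.indicator_nonneg (fun _ _ => zero_le_one) _

lemma inv_norm_mul_decay_le {d : ℕ} {r : ℝ} (hr : 0 ≤ r) (s x : Rd d) :
    ‖x‖⁻¹ * decay r (s + x) ≤
      (Set.Iio (1 : ℝ)).indicator (fun t => t⁻¹) ‖x‖ + decay r (s + x) := by
  have h0 := decay_nonneg r (s + x)
  have h1 := decay_le_one hr (s + x)
  by_cases h : ‖x‖ < 1
  · rw [Set.indicator_of_mem (show ‖x‖ ∈ Set.Iio (1 : ℝ) from h)]
    nlinarith [inv_nonneg.2 (norm_nonneg x)]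
  · rw [Set.indicator_of_notMem (show ‖x‖ ∉ Set.Iio (1 : ℝ) from h), zero_add]
    exact mul_le_of_le_one_left h0 (inv_le_one_of_one_le₀ (not_lt.1 h))

lemma exists_lintegral_inv_norm_mul_decay_le {d : ℕ} (hd : 2 ≤ d) {r : ℝ} (hr : (d : ℝ) < r) :
    ∃ C : NNReal, ∀ s : Rd d,
      ∫⁻ x : Rd d, ENNReal.ofReal (‖x‖⁻¹ * decay r (s + x)) ≤ C := by
  have hr0 : 0 ≤ r := (Nat.cast_nonneg d).trans hr.le
  have i1 := (integrable_indicator_ball_inv_norm hd).lintegral_lt_top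
  have i2 := (integrable_decay (E := Rd d) (μ := volume)
    (by rwa [finrank_euclideanSpace_fin])).lintegral_lt_top
  refine ⟨((∫⁻ x : Rd d, ENNReal.ofReal ((Set.Iio (1 : ℝ)).indicator (fun t => t⁻¹) ‖x‖)) +
    ∫⁻ x : Rd d, ENNReal.ofReal (decay r x)).toNNReal, fun s => ?_⟩
  rw [ENNReal.coe_toNNReal (ENNReal.add_lt_top.2 ⟨i1, i2⟩).ne]
  rw [← lintegral_add_left_eq_self (fun w : Rd d => ENNReal.ofReal (decay r w)) s]
  have hm : Measurable fun x : Rd d => decay r (s + x) :=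
    (continuous_decay r).measurable.comp (measurable_const_add s)
  rw [← lintegral_add_right _ hm.ennreal_ofReal]
  refine lintegral_mono fun x => ?_
  refine (ENNReal.ofReal_le_ofReal (inv_norm_mul_decay_le hr0 s x)).trans ?_
  exact ENNReal.ofReal_add_le

/-- The majorant of the kinetic integrand, with the hyperplane `x^⊥` parametrized by `e^⊥`. -/
def kinBound (d : ℕ) (r : ℝ) (e s : Rd d) (p : Rd d × (ℝ ∙ e)ᗮ) : ℝ :=
  ‖p.1‖⁻¹ * kinMajorant d r s p.1 (axisReflection e p.1 p.2)

lemma kinBound_nonneg (d : ℕ) (r : ℝ) (e s : Rd d) (p : Rd d × (ℝ ∙ e)ᗮ) :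
    0 ≤ kinBound d r e s p :=
  mul_nonneg (by positivity) (kinMajorant_nonneg _ _ _ _ _)

lemma measurable_kinBound (d : ℕ) (r : ℝ) (e s : Rd d) : Measurable (kinBound d r e s) := by
  have hD : Measurable (decay r : Rd d → ℝ) := (continuous_decay r).measurable
  have hR := measurable_axisReflection e
  unfold kinBound kinMajorant
  exact measurable_fst.norm.inv.mul
    (((hD.comp (measurable_fst.const_add s)).add ((hD.comp measurable_fst).const_mul _)).mul
      ((hD.comp (hR.const_add s)).add (hD.comp ((measurable_fst.const_add s).add hR))))

lemma exists_lintegral_kinBound_le {d : ℕ} (hd : 2 ≤ d) {r : ℝ} (hr : (d : ℝ) < r) (e : Rd d) :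
    ∃ C : NNReal, ∀ s : Rd d, ∫⁻ p, ENNReal.ofReal (kinBound d r e s p) ≤ C := by
  have hr0 : 0 ≤ r := (Nat.cast_nonneg d).trans hr.le
  obtain ⟨C, hC⟩ := exists_lintegral_inv_norm_mul_decay_le hd hr
  have hc := (integrable_decay_orthogonal hr e).lintegral_lt_top.ne
  set c := ∫⁻ w : (ℝ ∙ e)ᗮ, ENNReal.ofReal (decay r w)
  have hD : Measurable (decay r : Rd d → ℝ) := (continuous_decay r).measurable
  refine ⟨(C + (2 ^ r : ℝ).toNNReal * C) * (c + c).toNNReal, fun s => ?_⟩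
  have hcc : c + c ≠ ⊤ := ENNReal.add_ne_top.2 ⟨hc, hc⟩
  have inner (x : Rd d) : ∫⁻ w : (ℝ ∙ e)ᗮ, ENNReal.ofReal (kinBound d r e s (x, w)) ≤
      ENNReal.ofReal (‖x‖⁻¹ * (decay r (s + x) + 2 ^ r * decay r x)) * (c + c) := by
    have hR : Measurable fun w : (ℝ ∙ e)ᗮ => axisReflection e x (w : Rd d) :=
      (axisReflection e x).continuous.measurable.comp measurable_subtype_coe
    have hx : 0 ≤ ‖x‖⁻¹ * (decay r (s + x) + 2 ^ r * decay r x) :=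
      mul_nonneg (by positivity)
        (add_nonneg (decay_nonneg _ _) (mul_nonneg (by positivity) (decay_nonneg _ _)))
    simp only [kinBound, kinMajorant, ← mul_assoc]
    simp only [ENNReal.ofReal_mul hx]
    rw [lintegral_const_mul]
    · gcongr
      simp only [ENNReal.ofReal_add (decay_nonneg _ _) (decay_nonneg _ _)]
      have hs : Measurable fun w : (ℝ ∙ e)ᗮ => decay r (s + axisReflection e x (w : Rd d)) :=
        hD.comp (hR.const_add s)
      rw [lintegral_add_left hs.ennreal_ofReal]
      exact add_le_add (lintegral_decay_axisReflection_le hr0 e x s)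
        (lintegral_decay_axisReflection_le hr0 e x (s + x))
    · exact ((hD.comp (hR.const_add s)).add (hD.comp (hR.const_add (s + x)))).ennreal_ofReal
  change ∫⁻ p, _ ∂(volume.prod volume) ≤ _
  rw [lintegral_prod _ (measurable_kinBound d r e s).ennreal_ofReal.aemeasurable]
  refine (lintegral_mono inner).trans ?_
  rw [lintegral_mul_const']
  · push_cast
    rw [ENNReal.coe_toNNReal hcc]
    gcongr
    have split (x : Rd d) : ENNReal.ofReal (‖x‖⁻¹ * (decay r (s + x) + 2 ^ r * decay r x)) =
        ENNReal.ofReal (‖x‖⁻¹ * decay r (s + x)) +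
          ENNReal.ofReal (2 ^ r) * ENNReal.ofReal (‖x‖⁻¹ * decay r (0 + x)) := by
      rw [← ENNReal.ofReal_mul (by positivity), ← ENNReal.ofReal_add, zero_add]
      · congr 1; ring
      · exact mul_nonneg (by positivity) (decay_nonneg _ _)
      · exact mul_nonneg (by positivity) (mul_nonneg (by positivity) (decay_nonneg _ _))
    simp only [split]
    have hm (a : Rd d) : Measurable fun x : Rd d => ENNReal.ofReal (‖x‖⁻¹ * decay r (a + x)) :=
      (measurable_norm.inv.mul (hD.comp (measurable_const_add a))).ennreal_ofReal
    rw [lintegral_add_left (hm s), lintegral_const_mul _ (hm 0)]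
    exact add_le_add (hC s) (mul_le_mul' le_rfl (hC 0))
  · exact hcc

lemma exists_integral_kinBound_le {d : ℕ} (hd : 2 ≤ d) {r : ℝ} (hr : (d : ℝ) < r) (e : Rd d) :
    ∃ C : ℝ, 0 ≤ C ∧ ∀ s : Rd d,
      Integrable (kinBound d r e s) ∧ ∫ p, kinBound d r e s p ≤ C := by
  obtain ⟨C, hC⟩ := exists_lintegral_kinBound_le hd hr e
  refine ⟨C, C.2, fun s => ?_⟩
  have hi : Integrable (kinBound d r e s) := by
    refine ⟨(measurable_kinBound d r e s).aestronglyMeasurable, ?_⟩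
    rw [hasFiniteIntegral_iff_ofReal (.of_forall (kinBound_nonneg d r e s))]
    exact (hC s).trans_lt ENNReal.coe_lt_top
  refine ⟨hi, ?_⟩
  have := hC s
  rw [← ofReal_integral_eq_lintegral_ofReal hi (.of_forall (kinBound_nonneg d r e s))] at this
  exact (ENNReal.ofReal_le_iff_le_toReal ENNReal.coe_ne_top).1 this

/-- The integrand of the kinetic integral, with the hyperplane `x^⊥` parametrized by `e^⊥`. -/
def kinPullback (d : ℕ) (e : Rd d) (y : Rd d → ℝ) (s : Rd d) (p : Rd d × (ℝ ∙ e)ᗮ) : ℝ :=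
  ‖p.1‖⁻¹ * kinIntegrand d y s p.1 (axisReflection e p.1 p.2)

section KineticIntegral

variable {d : ℕ} {r : ℝ} {e : Rd d}

lemma measurable_kinPullback (e : Rd d) {y : Rd d → ℝ} (hy : Continuous y) (s : Rd d) :
    Measurable (kinPullback d e y s) := by
  have hR := measurable_axisReflection e
  have hm := hy.measurable
  have m1 := hm.comp ((measurable_fst : Measurable fun p : Rd d × (ℝ ∙ e)ᗮ => p.1).const_add s)
  have m2 := hm.comp (hR.const_add s)
  have m3 := hm.comp (((measurable_fst :
    Measurable fun p : Rd d × (ℝ ∙ e)ᗮ => p.1).const_add s).add hR)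
  unfold kinPullback kinIntegrand
  exact measurable_fst.norm.inv.mul (((((m1.mul m2).mul m3).add ((m1.mul m2).mul_const _)).sub
    ((m2.mul m3).mul_const _)).sub ((m1.mul m3).mul_const _))

lemma abs_kinPullback_sub_le {M δ : ℝ} (he : ‖e‖ = 1) (hr : 0 ≤ r) (hM : 0 ≤ M) (hδ : 0 ≤ δ)
    {y v : Rd d → ℝ} (hy : ∀ s, |y s| ≤ M * decay r s) (hv : ∀ s, |v s| ≤ M * decay r s)
    (hyv : ∀ s, |y s - v s| ≤ δ * decay r s) (s : Rd d) (p : Rd d × (ℝ ∙ e)ᗮ) :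
    |kinPullback d e y s p - kinPullback d e v s p| ≤
      3 * M ^ 2 * δ * (2 ^ r + 1) * decay r s * kinBound d r e s p := by
  unfold kinPullback kinBound
  rw [← mul_sub, abs_mul, abs_of_nonneg (by positivity)]
  refine (mul_le_mul_of_nonneg_left (abs_kinIntegrand_sub_le hr hM hδ hy hv hyv
    (inner_axisReflection_eq_zero he p.1 p.2)) (by positivity)).trans_eq ?_
  ring

lemma abs_kinPullback_le {M : ℝ} (he : ‖e‖ = 1) (hr : 0 ≤ r) (hM : 0 ≤ M)
    {y : Rd d → ℝ} (hy : ∀ s, |y s| ≤ M * decay r s) (s : Rd d) (p : Rd d × (ℝ ∙ e)ᗮ) :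
    |kinPullback d e y s p| ≤
      3 * M ^ 2 * M * (2 ^ r + 1) * decay r s * kinBound d r e s p := by
  have := abs_kinPullback_sub_le (v := fun _ => 0) he hr hM hM hy
    (fun s => by simpa using mul_nonneg hM (decay_nonneg r s)) (by simpa using hy) s p
  simpa [kinPullback, kinIntegrand] using this

lemma integrable_kinPullback (hd : 2 ≤ d) (hr : (d : ℝ) < r) (he : ‖e‖ = 1) {M : ℝ} (hM : 0 ≤ M)
    {y : Rd d → ℝ} (hyc : Continuous y) (hy : ∀ s, |y s| ≤ M * decay r s) (s : Rd d) :
    Integrable (kinPullback d e y s) := by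
  have hr0 : 0 ≤ r := (Nat.cast_nonneg d).trans hr.le
  obtain ⟨C, -, hC⟩ := exists_integral_kinBound_le hd hr e
  exact ((hC s).1.const_mul _).mono' (measurable_kinPullback e hyc s).aestronglyMeasurable
    (.of_forall fun p => abs_kinPullback_le he hr0 hM hy s p)

lemma Kwk_eq_integral_kinPullback (hd : 2 ≤ d) (hr : (d : ℝ) < r) (he : ‖e‖ = 1) {M : ℝ}
    (hM : 0 ≤ M) {y : Rd d → ℝ} (hyc : Continuous y) (hy : ∀ s, |y s| ≤ M * decay r s)
    (s : Rd d) : Kwk d y s = 2 * Real.pi * ∫ p, kinPullback d e y s p := by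
  unfold Kwk
  congr 1
  change _ = ∫ p, _ ∂(volume.prod volume)
  rw [integral_prod _ (integrable_kinPullback hd hr he hM hyc hy s)]
  congr 1
  ext x
  by_cases hx : x = 0
  · simp [hx, kinPullback]
  · rw [hyperplaneIntegral_eq he hx, ← integral_const_mul]
    rfl

lemma continuous_Kwk (hd : 2 ≤ d) (hr : (d : ℝ) < r) (he : ‖e‖ = 1) {M : ℝ}
    (hM : 0 ≤ M) {y : Rd d → ℝ} (hyc : Continuous y) (hy : ∀ s, |y s| ≤ M * decay r s) :
    Continuous (Kwk d y) := by
  have hr0 : 0 ≤ r := (Nat.cast_nonneg d).trans hr.le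
  obtain ⟨C, -, hC⟩ := exists_integral_kinBound_le hd hr e
  rw [funext (Kwk_eq_integral_kinPullback hd hr he hM hyc hy)]
  refine continuous_const.mul (continuous_iff_continuousAt.2 fun s₀ => ?_)
  refine continuousAt_of_dominated
    (bound := fun p => 3 * M ^ 2 * M * (2 ^ r + 1) * (2 ^ r * 2 ^ r * kinBound d r e s₀ p))
    (.of_forall fun s => (measurable_kinPullback e hyc s).aestronglyMeasurable) ?_
    (((hC s₀).1.const_mul _).const_mul _) (.of_forall fun p => ?_)
  · filter_upwards [Metric.ball_mem_nhds s₀ one_pos] with s hs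
    refine .of_forall fun p => (abs_kinPullback_le he hr0 hM hy s p).trans ?_
    rw [mul_assoc _ (decay r s)]
    refine mul_le_mul_of_nonneg_left ?_ (by positivity)
    refine (mul_le_of_le_one_left (kinBound_nonneg _ _ _ _ _) (decay_le_one hr0 s)).trans ?_
    have hs' : ‖s₀ - s‖ ≤ 1 := by
      rw [← dist_eq_norm, dist_comm]; exact (Metric.mem_ball.1 hs).le
    have shift (a : Rd d) : decay r (s + a) ≤ 2 ^ r * decay r (s₀ + a) :=
      decay_le_of_norm_sub_le hr0 (by simpa using hs')
    have h1 : (1 : ℝ) ≤ 2 ^ r := Real.one_le_rpow (by norm_num) hr0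
    unfold kinBound kinMajorant
    set z := axisReflection e p.1 (p.2 : Rd d)
    have b1 : decay r (s + p.1) + 2 ^ r * decay r p.1 ≤
        2 ^ r * (decay r (s₀ + p.1) + 2 ^ r * decay r p.1) := by
      have : 0 ≤ 2 ^ r * decay r p.1 := mul_nonneg (by positivity) (decay_nonneg _ _)
      nlinarith [shift p.1]
    have b2 : decay r (s + z) + decay r (s + p.1 + z) ≤
        2 ^ r * (decay r (s₀ + z) + decay r (s₀ + p.1 + z)) := by
      have := shift (p.1 + z)
      rw [← add_assoc, ← add_assoc] at this
      linarith [shift z]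
    calc _ ≤ ‖p.1‖⁻¹ * ((2 ^ r * (decay r (s₀ + p.1) + 2 ^ r * decay r p.1)) *
          (2 ^ r * (decay r (s₀ + z) + decay r (s₀ + p.1 + z)))) := by
          have hp := fun v : Rd d => decay_nonneg r v
          gcongr
          · exact add_nonneg (hp _) (hp _)
          · exact mul_nonneg (by positivity)
              (add_nonneg (hp _) (mul_nonneg (by positivity) (hp _)))
      _ = _ := by ring
  · unfold kinPullback kinIntegrand
    fun_prop

lemma exists_abs_Kwk_sub_le (hd : 2 ≤ d) (hr : (d : ℝ) < r) :
    ∃ L : ℝ, 0 < L ∧ ∀ M δ : ℝ, 0 ≤ M → 0 ≤ δ → ∀ y v : Rd d → ℝ, Continuous y → Continuous v →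
      (∀ s, |y s| ≤ M * decay r s) → (∀ s, |v s| ≤ M * decay r s) →
      (∀ s, |y s - v s| ≤ δ * decay r s) →
      ∀ s, |Kwk d y s - Kwk d v s| ≤ L * M ^ 2 * δ * decay r s := by
  have hr0 : 0 ≤ r := (Nat.cast_nonneg d).trans hr.le
  set e : Rd d := EuclideanSpace.single ⟨0, by omega⟩ 1
  have he : ‖e‖ = 1 := by simp [e]
  obtain ⟨C, hC0, hC⟩ := exists_integral_kinBound_le hd hr e
  refine ⟨2 * Real.pi * 3 * (2 ^ r + 1) * C + 1, by positivity, ?_⟩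
  intro M δ hM hδ y v hyc hvc hy hv hyv s
  have iy := integrable_kinPullback hd hr he hM hyc hy s
  have iv := integrable_kinPullback hd hr he hM hvc hv s
  rw [Kwk_eq_integral_kinPullback hd hr he hM hyc hy,
    Kwk_eq_integral_kinPullback hd hr he hM hvc hv, ← mul_sub, ← integral_sub iy iv, abs_mul,
    abs_of_nonneg (by positivity)]
  have h1 : |∫ p, (kinPullback d e y s p - kinPullback d e v s p)| ≤
      3 * M ^ 2 * δ * (2 ^ r + 1) * decay r s * C := by
    refine (norm_integral_le_of_norm_le
      (f := fun p => kinPullback d e y s p - kinPullback d e v s p) ((hC s).1.const_mul _)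
      (.of_forall fun p => abs_kinPullback_sub_le he hr0 hM hδ hy hv hyv s p)).trans ?_
    rw [integral_const_mul]
    have := decay_nonneg r s
    gcongr
    exact (hC s).2
  refine (mul_le_mul_of_nonneg_left h1 (by positivity)).trans ?_
  have : 0 ≤ M ^ 2 * δ * decay r s := mul_nonneg (by positivity) (decay_nonneg r s)
  linarith

end KineticIntegral

section Duhamel

lemma integral_exp_damping {g : ℝ} (hg : g ≠ 0) (a τ : ℝ) :
    ∫ l in a..τ, Real.exp (-2 * g * (τ - l)) = (1 - Real.exp (-2 * g * (τ - a))) / (2 * g) := by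
  have hderiv (l : ℝ) : HasDerivAt (fun l => Real.exp (-2 * g * (τ - l)) / (2 * g))
      (Real.exp (-2 * g * (τ - l))) l := by
    have h := ((((hasDerivAt_id l).const_sub τ).const_mul (-2 * g)).exp).div_const (2 * g)
    refine h.congr_deriv ?_
    simp only [id]
    field_simp
  rw [intervalIntegral.integral_eq_sub_of_hasDerivAt (fun l _ => hderiv l)
    (by apply Continuous.intervalIntegrable; fun_prop)]
  simp [sub_div]

lemma abs_integral_damping_mul_le {g a τ B : ℝ} (hg : 0 < g) (haτ : a ≤ τ) (hB : 0 ≤ B)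
    {f : ℝ → ℝ} (hf : ∀ l ∈ Set.Icc a τ, |f l| ≤ B) :
    |∫ l in a..τ, Real.exp (-2 * g * (τ - l)) * f l| ≤ B / (2 * g) := by
  have h := intervalIntegral.norm_integral_le_of_norm_le (μ := volume) haτ
    (f := fun l => Real.exp (-2 * g * (τ - l)) * f l)
    (g := fun l => Real.exp (-2 * g * (τ - l)) * B)
    (.of_forall fun l hl => by
      rw [norm_mul, Real.norm_of_nonneg (Real.exp_pos _).le]
      exact mul_le_mul_of_nonneg_left (hf l ⟨hl.1.le, hl.2⟩) (Real.exp_pos _).le)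
    (by apply Continuous.intervalIntegrable; fun_prop)
  rw [intervalIntegral.integral_mul_const, integral_exp_damping hg.ne'] at h
  refine h.trans ?_
  rw [div_mul_eq_mul_div]
  gcongr
  exact mul_le_of_le_one_left hB (by linarith [Real.exp_pos (-2 * g * (τ - a))])

lemma abs_integral_damping_mul_le_half {g a τ B : ℝ} (hg : 1 ≤ g) (haτ : a ≤ τ) (hB : 0 ≤ B)
    {f : ℝ → ℝ} (hf : ∀ l ∈ Set.Icc a τ, |f l| ≤ B) :
    |∫ l in a..τ, Real.exp (-2 * g * (τ - l)) * f l| ≤ B / 2 :=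
  (abs_integral_damping_mul_le (by linarith) haτ hB hf).trans
    (div_le_div_of_nonneg_left hB (by norm_num) (by linarith))

lemma abs_integral_damping_mul_sub_le {g a σ τ B : ℝ} (hg : 0 < g) (haσ : a ≤ σ) (hστ : σ ≤ τ)
    (hB : 0 ≤ B) {f : ℝ → ℝ} (hfc : Continuous f) (hf : ∀ l, |f l| ≤ B) :
    |(∫ l in a..τ, Real.exp (-2 * g * (τ - l)) * f l) -
      ∫ l in a..σ, Real.exp (-2 * g * (σ - l)) * f l| ≤ 2 * B * (τ - σ) := by
  have hi (p q : ℝ) : IntervalIntegrable (fun l => Real.exp (-2 * g * (τ - l)) * f l) volume p q :=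
    by apply Continuous.intervalIntegrable; fun_prop
  rw [← intervalIntegral.integral_add_adjacent_intervals (hi a σ) (hi σ τ)]
  have h1 : ∫ l in a..σ, Real.exp (-2 * g * (τ - l)) * f l =
      Real.exp (-2 * g * (τ - σ)) * ∫ l in a..σ, Real.exp (-2 * g * (σ - l)) * f l := by
    rw [← intervalIntegral.integral_const_mul]
    congr 1
    ext l
    rw [← mul_assoc, ← Real.exp_add]
    ring_nf
  have h2 : |∫ l in σ..τ, Real.exp (-2 * g * (τ - l)) * f l| ≤ B * (τ - σ) := by
    have := intervalIntegral.norm_integral_le_of_norm_le_const (a := σ) (b := τ) (C := B)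
      (f := fun l => Real.exp (-2 * g * (τ - l)) * f l) (fun l hl => by
        rw [Set.uIoc_of_le hστ] at hl
        rw [norm_mul, Real.norm_of_nonneg (Real.exp_pos _).le]
        have : Real.exp (-2 * g * (τ - l)) ≤ 1 := Real.exp_le_one_iff.2 (by nlinarith [hl.2])
        exact (mul_le_of_le_one_left (norm_nonneg _) this).trans (hf l))
    rwa [abs_of_nonneg (sub_nonneg.2 hστ)] at this
  have h3 := abs_integral_damping_mul_le hg haσ hB (fun l _ => hf l)
  rw [h1]
  set J := ∫ l in a..σ, Real.exp (-2 * g * (σ - l)) * f l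
  have h4 : |(Real.exp (-2 * g * (τ - σ)) - 1) * J| ≤ B * (τ - σ) := by
    have e1 : Real.exp (-2 * g * (τ - σ)) ≤ 1 := Real.exp_le_one_iff.2 (by nlinarith)
    have e2 := Real.add_one_le_exp (-2 * g * (τ - σ))
    rw [abs_mul, abs_of_nonpos (by linarith)]
    calc _ ≤ (2 * g * (τ - σ)) * (B / (2 * g)) := by
          gcongr
          linarith
      _ = _ := by field_simp
  have e : ∀ c I : ℝ, c * J + I - J = (c - 1) * J + I := fun _ _ => by ring
  rw [e]
  refine (abs_add_le _ _).trans ?_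
  linarith

open BoundedContinuousFunction in
lemma exists_bcf_duhamel {X : Type*} [TopologicalSpace X] {g : X → ℝ}
    (hg : Continuous g) (hg1 : ∀ s, 1 ≤ g s) (a : ℝ) {B : ℝ} (F : ℝ → X →ᵇ ℝ)
    (hF : Continuous F) (hFB : ∀ l, ‖F l‖ ≤ B) :
    ∃ D : ℝ →ᵇ (X →ᵇ ℝ), ∀ τ s,
      D τ s = ∫ l in a..max τ a, Real.exp (-2 * g s * (max τ a - l)) * F l s := by
  have hB : 0 ≤ B := (norm_nonneg _).trans (hFB 0)
  have hFs (s : X) : Continuous fun l => F l s := (continuous_eval_const s).comp hF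
  have hFb (l : ℝ) (s : X) : |F l s| ≤ B := ((F l).norm_coe_le_norm s).trans (hFB l)
  have hjoint : Continuous fun p : X × ℝ => F p.2 p.1 := by fun_prop
  have hbound (τ : ℝ) (s : X) :
      |∫ l in a..max τ a, Real.exp (-2 * g s * (max τ a - l)) * F l s| ≤ B / 2 :=
    abs_integral_damping_mul_le_half (hg1 s) (le_max_right _ _) hB fun l _ => hFb l s
  have hcont (τ : ℝ) : Continuous fun s =>
      ∫ l in a..max τ a, Real.exp (-2 * g s * (max τ a - l)) * F l s := by
    refine intervalIntegral.continuous_parametric_intervalIntegral_of_continuous ?_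
      continuous_const
    exact (by fun_prop : Continuous fun p : X × ℝ =>
      Real.exp (-2 * g p.1 * (max τ a - p.2))).mul hjoint
  let D (τ : ℝ) : X →ᵇ ℝ := ofNormedAddCommGroup _ (hcont τ) (B / 2) (hbound τ)
  have hlip : LipschitzWith (2 * B).toNNReal D := by
    have key {σ τ : ℝ} (h : σ ≤ τ) : dist (D τ) (D σ) ≤ 2 * B * |τ - σ| := by
      refine (dist_le (by positivity)).2 fun s => ?_
      refine (abs_integral_damping_mul_sub_le (by linarith [hg1 s]) (le_max_right σ a)
        (max_le_max_right a h) hB (hFs s) fun l => hFb l s).trans ?_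
      gcongr
      exact (le_abs_self _).trans (abs_max_sub_max_le_abs _ _ _)
    refine LipschitzWith.of_dist_le_mul fun τ σ => ?_
    rw [Real.coe_toNNReal _ (by positivity), Real.dist_eq]
    rcases le_total σ τ with h | h
    · exact key h
    · rw [dist_comm, abs_sub_comm]; exact key h
  exact ⟨ofNormedAddCommGroup D hlip.continuous (B / 2)
    fun τ => norm_ofNormedAddCommGroup_le _ (by positivity) _, fun τ s => rfl⟩

end Duhamel

section FixedPoint

open BoundedContinuousFunction

variable {X : Type*} [TopologicalSpace X] {g : X → ℝ} {a A L ε : ℝ} {β : X →ᵇ ℝ}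
  {G : (X →ᵇ ℝ) → X →ᵇ ℝ}

lemma continuous_of_norm_sub_le_mul_sq
    (hG : ∀ M, 0 ≤ M → ∀ u v, ‖u‖ ≤ M → ‖v‖ ≤ M → ‖G u - G v‖ ≤ L * M ^ 2 * ‖u - v‖) :
    Continuous G := by
  refine continuous_iff_continuousAt.2 fun u => ?_
  refine continuousAt_of_locally_lipschitz one_pos (L * (‖u‖ + 1) ^ 2) fun v hv => ?_
  rw [dist_eq_norm] at hv
  rw [dist_eq_norm, dist_eq_norm]
  have := norm_sub_norm_le v u
  exact hG _ (by positivity) _ _ (by linarith) (by linarith)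

lemma norm_le_mul_sq_mul (hG0 : G 0 = 0)
    (hG : ∀ M, 0 ≤ M → ∀ u v, ‖u‖ ≤ M → ‖v‖ ≤ M → ‖G u - G v‖ ≤ L * M ^ 2 * ‖u - v‖)
    {M : ℝ} (hM : 0 ≤ M) {u : X →ᵇ ℝ} (hu : ‖u‖ ≤ M) : ‖G u‖ ≤ L * M ^ 2 * ‖u‖ := by
  simpa [hG0] using hG M hM u 0 hu (by simpa using hM)

lemma exists_duhamel_fixedPoint (hg : Continuous g) (hg1 : ∀ s, 1 ≤ g s) (a : ℝ) (hL : 0 ≤ L)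
    (hG0 : G 0 = 0)
    (hG : ∀ M, 0 ≤ M → ∀ u v, ‖u‖ ≤ M → ‖v‖ ≤ M → ‖G u - G v‖ ≤ L * M ^ 2 * ‖u - v‖)
    (hA : 0 ≤ A) (hβ : ‖β‖ ≤ A) (hε : 0 ≤ ε) (hεL : ε * (L * (2 * A) ^ 2) ≤ 1 / 2) :
    ∃ u : ℝ →ᵇ (X →ᵇ ℝ), ∀ τ s, u τ s = ∫ l in a..max τ a,
      Real.exp (-2 * g s * (max τ a - l)) * (2 * β s + ε * G (u l) s) := by
  have hGc := continuous_of_norm_sub_le_mul_sq hG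
  have hex (u : ℝ →ᵇ (X →ᵇ ℝ)) : ∃ D : ℝ →ᵇ (X →ᵇ ℝ), ∀ τ s, D τ s = ∫ l in a..max τ a,
      Real.exp (-2 * g s * (max τ a - l)) * ((2 : ℝ) • β + ε • G (u l)) s := by
    refine exists_bcf_duhamel hg hg1 a (B := 2 * A + ε * (L * ‖u‖ ^ 2 * ‖u‖))
      (fun l => (2 : ℝ) • β + ε • G (u l))
      (continuous_const.add ((hGc.comp u.continuous).const_smul ε)) fun l => ?_
    refine (norm_add_le _ _).trans ?_
    rw [norm_smul, norm_smul, Real.norm_of_nonneg hε, Real.norm_of_nonneg (by norm_num)]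
    have h1 := norm_le_mul_sq_mul hG0 hG (norm_nonneg u) (u.norm_coe_le_norm l)
    have h2 := h1.trans (mul_le_mul_of_nonneg_left (u.norm_coe_le_norm l) (by positivity))
    gcongr
  choose Φ hΦ using hex
  set M := 2 * A
  have hM : 0 ≤ M := by positivity
  set S : Set (ℝ →ᵇ (X →ᵇ ℝ)) := Metric.closedBall 0 M
  have hS {u : ℝ →ᵇ (X →ᵇ ℝ)} : u ∈ S ↔ ‖u‖ ≤ M := Iff.rfl
  have hmaps : Set.MapsTo Φ S S := fun u hu => by
    rw [hS] at hu ⊢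
    refine (norm_le hM).2 fun τ => (norm_le hM).2 fun s => ?_
    rw [hΦ, Real.norm_eq_abs]
    refine (abs_integral_damping_mul_le_half (B := 2 * A + 1 / 2 * M) (hg1 s) (le_max_right _ _)
      (by positivity) fun l _ => ?_).trans (by linarith)
    refine (((2 : ℝ) • β + ε • G (u l)).norm_coe_le_norm s).trans ((norm_add_le _ _).trans ?_)
    rw [norm_smul, norm_smul, Real.norm_of_nonneg hε, Real.norm_of_nonneg (by norm_num)]
    have hul := (u.norm_coe_le_norm l).trans hu
    have h1 := norm_le_mul_sq_mul hG0 hG hM hul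
    have h2 : ε * ‖G (u l)‖ ≤ 1 / 2 * M := calc
      _ ≤ ε * (L * M ^ 2 * ‖u l‖) := by gcongr
      _ = ε * (L * M ^ 2) * ‖u l‖ := by ring
      _ ≤ _ := by gcongr
    linarith
  have hcontr : ContractingWith (1 / 4) (hmaps.restrict Φ S S) := by
    refine ⟨by rw [← NNReal.coe_lt_coe]; norm_num, LipschitzWith.of_dist_le_mul fun u v => ?_⟩
    obtain ⟨u, hu⟩ := u
    obtain ⟨v, hv⟩ := v
    rw [hS] at hu hv
    rw [Subtype.dist_eq, Subtype.dist_eq]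
    simp only [Set.MapsTo.val_restrict_apply]
    have hd : 0 ≤ ((1 / 4 : NNReal) : ℝ) * dist u v := by positivity
    refine (dist_le hd).2 fun τ => (dist_le hd).2 fun s => ?_
    have hi (w : ℝ →ᵇ (X →ᵇ ℝ)) : IntervalIntegrable (fun l =>
        Real.exp (-2 * g s * (max τ a - l)) * ((2 : ℝ) • β + ε • G (w l)) s)
        volume a (max τ a) := by
      refine Continuous.intervalIntegrable ?_ _ _
      have h1 : Continuous fun l => G (w l) s :=
        (continuous_eval_const s).comp (hGc.comp w.continuous)
      simp only [coe_add, coe_smul, Pi.add_apply, smul_eq_mul]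
      fun_prop
    rw [hΦ, hΦ, Real.dist_eq, ← intervalIntegral.integral_sub (hi u) (hi v)]
    simp only [← mul_sub]
    refine (abs_integral_damping_mul_le_half (B := 1 / 2 * dist u v) (hg1 s) (le_max_right _ _)
      (by positivity) fun l _ => ?_).trans (by push_cast; linarith)
    have e : ((2 : ℝ) • β + ε • G (u l)) s - ((2 : ℝ) • β + ε • G (v l)) s =
        ε * (G (u l) - G (v l)) s := by
      simp only [coe_add, coe_smul, Pi.add_apply, smul_eq_mul, coe_sub, Pi.sub_apply]; ring
    rw [e, abs_mul, abs_of_nonneg hε]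
    have h1 := hG M hM _ _ ((u.norm_coe_le_norm l).trans hu) ((v.norm_coe_le_norm l).trans hv)
    have h2 : ‖u l - v l‖ ≤ dist u v := by
      rw [← dist_eq_norm]; exact dist_coe_le_dist l
    calc _ ≤ ε * ‖G (u l) - G (v l)‖ := by
          gcongr; exact (G (u l) - G (v l)).norm_coe_le_norm s
      _ ≤ ε * (L * M ^ 2 * dist u v) := by
          gcongr; exact h1.trans (mul_le_mul_of_nonneg_left h2 (by positivity))
      _ = ε * (L * M ^ 2) * dist u v := by ring
      _ ≤ _ := by gcongr
  obtain ⟨u, -, hu, -⟩ := ContractingWith.exists_fixedPoint' (x := 0)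
    Metric.isClosed_closedBall.isComplete hmaps hcontr (Metric.mem_closedBall_self hM)
    (edist_ne_top _ _)
  refine ⟨u, fun τ s => ?_⟩
  conv_lhs => rw [← hu.eq]
  exact hΦ u τ s

lemma abs_sub_linear_le_of_norm_le (hg1 : ∀ s, 1 ≤ g s) (hL : 0 ≤ L) (hG0 : G 0 = 0)
    (hG : ∀ M, 0 ≤ M → ∀ u v, ‖u‖ ≤ M → ‖v‖ ≤ M → ‖G u - G v‖ ≤ L * M ^ 2 * ‖u - v‖)
    (hε : 0 ≤ ε) {M : ℝ} (hM : 0 ≤ M) {U : ℝ → X →ᵇ ℝ} (hU : ContinuousOn U (Set.Ici a))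
    {τ : ℝ} (hτ : a ≤ τ) {s : X}
    (hsol : U τ s = ∫ l in a..τ, Real.exp (-2 * g s * (τ - l)) * (2 * β s + ε * G (U l) s))
    (hUM : ∀ l ∈ Set.Icc a τ, ‖U l‖ ≤ M) :
    |U τ s - β s / g s * (1 - Real.exp (-2 * g s * (τ - a)))| ≤ ε * (L * M ^ 2) * M / 2 := by
  have hGc := continuous_of_norm_sub_le_mul_sq hG
  have hgs : 0 < g s := by linarith [hg1 s]
  have i1 : IntervalIntegrable (fun l => Real.exp (-2 * g s * (τ - l)) * (2 * β s))
      volume a τ := by apply Continuous.intervalIntegrable; fun_prop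
  have i2 : IntervalIntegrable (fun l => Real.exp (-2 * g s * (τ - l)) * (ε * G (U l) s))
      volume a τ := by
    refine ContinuousOn.intervalIntegrable ?_
    rw [Set.uIcc_of_le hτ]
    have : ContinuousOn (fun l => G (U l) s) (Set.Icc a τ) :=
      ((continuous_eval_const s).comp hGc).comp_continuousOn (hU.mono Set.Icc_subset_Ici_self)
    exact (by fun_prop : Continuous fun l => Real.exp (-2 * g s * (τ - l))).continuousOn.mul
      (continuousOn_const.mul this)
  have e : U τ s - β s / g s * (1 - Real.exp (-2 * g s * (τ - a))) =
      ∫ l in a..τ, Real.exp (-2 * g s * (τ - l)) * (ε * G (U l) s) := by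
    rw [hsol]
    simp only [mul_add]
    rw [intervalIntegral.integral_add i1 i2, intervalIntegral.integral_mul_const,
      integral_exp_damping hgs.ne']
    rw [show (1 - Real.exp (-2 * g s * (τ - a))) / (2 * g s) * (2 * β s) =
      β s / g s * (1 - Real.exp (-2 * g s * (τ - a))) by field_simp, add_sub_cancel_left]
  rw [e]
  refine abs_integral_damping_mul_le_half (hg1 s) hτ (by positivity) fun l hl => ?_
  rw [abs_mul, abs_of_nonneg hε, mul_assoc]
  gcongr
  refine ((G (U l)).norm_coe_le_norm s).trans ?_
  exact (norm_le_mul_sq_mul hG0 hG hM (hUM l hl)).trans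
    (mul_le_mul_of_nonneg_left (hUM l hl) (by positivity))

lemma norm_le_of_abs_sub_linear_le (hg1 : ∀ s, 1 ≤ g s) (hA : 0 ≤ A) (hβ : ‖β‖ ≤ A)
    {τ B : ℝ} (hB : 0 ≤ B) (hτ : a ≤ τ) {u : X →ᵇ ℝ}
    (h : ∀ s, |u s - β s / g s * (1 - Real.exp (-2 * g s * (τ - a)))| ≤ B) : ‖u‖ ≤ A + B := by
  refine (norm_le (by positivity)).2 fun s => ?_
  have hgs := hg1 s
  have e1 : Real.exp (-2 * g s * (τ - a)) ≤ 1 := Real.exp_le_one_iff.2 (by nlinarith)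
  have h1 : |β s / g s * (1 - Real.exp (-2 * g s * (τ - a)))| ≤ A := by
    rw [abs_mul, abs_div, abs_of_pos (by linarith : 0 < g s), abs_of_nonneg (sub_nonneg.2 e1)]
    refine (mul_le_of_le_one_right (by positivity)
      (by linarith [Real.exp_pos (-2 * g s * (τ - a))])).trans ?_
    exact (div_le_self (abs_nonneg _) hgs).trans ((β.norm_coe_le_norm s).trans hβ)
  have h2 := h s
  rw [Real.norm_eq_abs]
  rw [abs_le] at *
  constructor <;> linarith

lemma norm_le_of_duhamel (hg1 : ∀ s, 1 ≤ g s) (hL : 0 ≤ L) (hG0 : G 0 = 0)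
    (hG : ∀ M, 0 ≤ M → ∀ u v, ‖u‖ ≤ M → ‖v‖ ≤ M → ‖G u - G v‖ ≤ L * M ^ 2 * ‖u - v‖)
    (hA : 0 < A) (hβ : ‖β‖ ≤ A) (hε : 0 ≤ ε) (hεL : ε * (L * (2 * A) ^ 2) ≤ 1 / 2)
    {U : ℝ → X →ᵇ ℝ} (hU : ContinuousOn U (Set.Ici a))
    (hsol : ∀ τ, a ≤ τ → ∀ s,
      U τ s = ∫ l in a..τ, Real.exp (-2 * g s * (τ - l)) * (2 * β s + ε * G (U l) s))
    {τ : ℝ} (hτ : a ≤ τ) : ‖U τ‖ ≤ 2 * A := by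
  by_contra! hlt
  have hn : ContinuousOn (fun l => ‖U l‖) (Set.Icc a τ) :=
    (hU.mono Set.Icc_subset_Ici_self).norm
  have hUa : U a = 0 := by ext s; rw [hsol a le_rfl s]; simp
  obtain ⟨σ, ⟨⟨hσ1, hσ2⟩, hσM⟩, hmin⟩ : ∃ σ, IsLeast
      (Set.Icc a τ ∩ (fun l => ‖U l‖) ⁻¹' Set.Ici (2 * A)) σ :=
    (isCompact_Icc.of_isClosed_subset (hn.preimage_isClosed_of_isClosed isClosed_Icc isClosed_Ici)
      Set.inter_subset_left).exists_isLeast ⟨τ, ⟨hτ, le_rfl⟩, hlt.le⟩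
  obtain ⟨ρ, hρ, hρM⟩ : 2 * A ∈ (fun l => ‖U l‖) '' Set.Icc a σ :=
    intermediate_value_Icc hσ1 (hn.mono (Set.Icc_subset_Icc_right hσ2))
      ⟨by simp only [hUa, norm_zero]; positivity, hσM⟩
  have hρσ : ρ = σ :=
    le_antisymm hρ.2 (hmin ⟨⟨hρ.1, hρ.2.trans hσ2⟩, hρM.ge⟩)
  subst hρσ
  have hle (l) (hl : l ∈ Set.Icc a ρ) : ‖U l‖ ≤ 2 * A := by
    rcases hl.2.eq_or_lt with rfl | h
    · exact hρM.le
    · by_contra! h'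
      exact absurd (hmin ⟨⟨hl.1, hl.2.trans hσ2⟩, h'.le⟩) (not_le.2 h)
  have h1 := norm_le_of_abs_sub_linear_le hg1 hA.le hβ (by positivity) hσ1 fun s =>
    abs_sub_linear_le_of_norm_le hg1 hL hG0 hG hε (by positivity) hU hσ1 (hsol ρ hσ1 s) hle
  have h2 : ε * (L * (2 * A) ^ 2) * (2 * A) ≤ 1 / 2 * (2 * A) := by gcongr
  simp only at hρM
  linarith

end FixedPoint

section WeightedSpace

open BoundedContinuousFunction

variable {d : ℕ} {r : ℝ}

/-- The element `(1 + ‖·‖)^{-r} u` of `C_r` attached to a bounded continuous function `u`. -/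
def unweight (r : ℝ) (u : Rd d →ᵇ ℝ) (s : Rd d) : ℝ := decay r s * u s

lemma continuous_unweight (r : ℝ) (u : Rd d →ᵇ ℝ) : Continuous (unweight r u) :=
  (continuous_decay r).mul u.continuous

lemma abs_unweight (r : ℝ) (u : Rd d →ᵇ ℝ) (s : Rd d) :
    |unweight r u s| = decay r s * |u s| := by
  rw [unweight, abs_mul, abs_of_nonneg (decay_nonneg _ _)]

lemma weight_mul_abs_unweight (r : ℝ) (u : Rd d →ᵇ ℝ) (s : Rd d) :
    (1 + ‖s‖) ^ r * |unweight r u s| = |u s| := by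
  rw [abs_unweight, ← mul_assoc, weight_mul_decay, one_mul]

lemma abs_unweight_le {M : ℝ} {u : Rd d →ᵇ ℝ} (hu : ‖u‖ ≤ M) (s : Rd d) :
    |unweight r u s| ≤ M * decay r s := by
  rw [abs_unweight, mul_comm]
  exact mul_le_mul_of_nonneg_right ((u.norm_coe_le_norm s).trans hu) (decay_nonneg _ _)

lemma unweight_sub (u v : Rd d →ᵇ ℝ) (s : Rd d) :
    unweight r (u - v) s = unweight r u s - unweight r v s := by
  simp [unweight, mul_sub]

lemma memCr_unweight (r : ℝ) (u : Rd d →ᵇ ℝ) : memCr d r (unweight r u) :=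
  ⟨continuous_unweight r u, ‖u‖, fun s => by
    rw [weight_mul_abs_unweight]; exact u.norm_coe_le_norm s⟩

lemma wNorm_unweight (r : ℝ) (u : Rd d →ᵇ ℝ) : wNorm d r (unweight r u) = ‖u‖ := by
  simp only [wNorm, weight_mul_abs_unweight, norm_eq_iSup_norm, Real.norm_eq_abs]

lemma memCr.exists_unweight_eq {y : Rd d → ℝ} (h : memCr d r y) :
    ∃ u : Rd d →ᵇ ℝ, unweight r u = y := by
  obtain ⟨hy, K, hK⟩ := h
  have hc : Continuous fun s : Rd d => (1 + ‖s‖) ^ r * y s :=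
    ((continuous_const.add continuous_norm).rpow_const
      fun s => Or.inl (by positivity : (1 + ‖s‖) ≠ 0)).mul hy
  refine ⟨ofNormedAddCommGroup _ hc K fun s => ?_, ?_⟩
  · rw [norm_mul, Real.norm_of_nonneg (by positivity)]
    exact hK s
  · ext s
    change decay r s * ((1 + ‖s‖) ^ r * y s) = y s
    rw [← mul_assoc, decay_mul_weight, one_mul]

lemma exists_weighted_Kwk (hd : 2 ≤ d) (hr : (d : ℝ) < r) :
    ∃ (L : ℝ) (G : (Rd d →ᵇ ℝ) → Rd d →ᵇ ℝ), 0 < L ∧ G 0 = 0 ∧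
      (∀ M, 0 ≤ M → ∀ u v, ‖u‖ ≤ M → ‖v‖ ≤ M → ‖G u - G v‖ ≤ L * M ^ 2 * ‖u - v‖) ∧
      ∀ u, unweight r (G u) = Kwk d (unweight r u) := by
  obtain ⟨L, hL, hK⟩ := exists_abs_Kwk_sub_le hd hr
  have hK0 (s : Rd d) : Kwk d (fun _ => 0) s = 0 := by
    simp [Kwk, hyperplaneIntegral, kinIntegrand]
  have hmem (u : Rd d →ᵇ ℝ) : memCr d r (Kwk d (unweight r u)) := by
    have he : ‖(EuclideanSpace.single ⟨0, by omega⟩ 1 : Rd d)‖ = 1 := by simp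
    refine ⟨continuous_Kwk hd hr he (norm_nonneg u) (continuous_unweight r u)
      (abs_unweight_le le_rfl), L * ‖u‖ ^ 2 * ‖u‖, fun s => ?_⟩
    rw [← abs_le_mul_decay_iff]
    have := hK ‖u‖ ‖u‖ (norm_nonneg _) (norm_nonneg _) (unweight r u) (fun _ => 0)
      (continuous_unweight r u) continuous_const (abs_unweight_le le_rfl)
      (fun s => by simpa using mul_nonneg (norm_nonneg u) (decay_nonneg r s))
      (fun s => by simpa using abs_unweight_le le_rfl s) s
    rwa [hK0, sub_zero] at this
  choose G hG using fun u => (hmem u).exists_unweight_eq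
  refine ⟨L, G, hL, ?_, fun M hM u v hu hv => ?_, hG⟩
  · ext s
    have h0 : unweight r (0 : Rd d →ᵇ ℝ) = fun _ => 0 := by ext; simp [unweight]
    have h := congrFun (hG 0) s
    rw [h0, hK0] at h
    simpa [unweight, (decay_pos r s).ne'] using h
  · refine (norm_le (by positivity)).2 fun s => ?_
    have h := hK M ‖u - v‖ hM (norm_nonneg _) _ _ (continuous_unweight r u)
      (continuous_unweight r v) (abs_unweight_le hu) (abs_unweight_le hv)
      (fun s => by rw [← unweight_sub]; exact abs_unweight_le le_rfl s) s
    rw [← hG, ← hG, ← unweight_sub, abs_le_mul_decay_iff, weight_mul_abs_unweight] at h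
    exact h

lemma SchwartzMap.memCr_sq (b : SchwartzMap (Rd d) ℝ) :
    memCr d r fun s => b s ^ 2 := by
  have bound (k : ℕ) : ∃ C, ∀ s, (1 + ‖s‖) ^ k * ‖b s‖ ≤ C := by
    refine ⟨2 ^ k * ((Finset.Iic (k, 0)).sup fun m => SchwartzMap.seminorm ℝ m.1 m.2) b,
      fun s => ?_⟩
    have := SchwartzMap.one_add_le_sup_seminorm_apply (𝕜 := ℝ) (m := (k, 0)) (k := k) (n := 0)
      le_rfl le_rfl b s
    rwa [norm_iteratedFDeriv_zero] at this
  obtain ⟨C₀, h₀⟩ := bound 0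
  obtain ⟨C₁, h₁⟩ := bound ⌈r⌉₊
  refine ⟨b.continuous.pow 2, C₁ * C₀, fun s => ?_⟩
  have hrpow : (1 + ‖s‖) ^ r ≤ (1 + ‖s‖) ^ ⌈r⌉₊ := by
    rw [← Real.rpow_natCast]
    exact Real.rpow_le_rpow_of_exponent_le (by linarith [norm_nonneg s]) (Nat.le_ceil r)
  have h0 := h₀ s
  rw [pow_zero, one_mul] at h0
  rw [abs_pow, sq, ← mul_assoc]
  exact mul_le_mul ((mul_le_mul_of_nonneg_right hrpow (abs_nonneg _)).trans (h₁ s)) h0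
    (abs_nonneg _) ((by positivity : (0 : ℝ) ≤ (1 + ‖s‖) ^ ⌈r⌉₊ * ‖b s‖).trans (h₁ s))

lemma one_le_gam {rstar : ℝ} (hrstar : 0 ≤ rstar) (s : Rd d) : 1 ≤ gam d rstar s :=
  Real.one_le_rpow (by nlinarith [norm_nonneg s]) hrstar

lemma continuous_gam (d : ℕ) (rstar : ℝ) : Continuous (gam d rstar) :=
  (continuous_const.add (continuous_norm.pow 2)).rpow_const
    fun s => Or.inl (by positivity : (1 + ‖s‖ ^ 2) ≠ 0)

lemma unweight_duhamel_iff {b : Rd d → ℝ} {β : Rd d →ᵇ ℝ} {G : (Rd d →ᵇ ℝ) → Rd d →ᵇ ℝ}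
    (hβ : unweight r β = fun s => b s ^ 2) (hG : ∀ u, unweight r (G u) = Kwk d (unweight r u))
    {rstar ε a τ : ℝ} (hτ : a ≤ τ) {m : ℝ → Rd d → ℝ} {U : ℝ → Rd d →ᵇ ℝ}
    (hU : ∀ l, a ≤ l → unweight r (U l) = m l) (s : Rd d) :
    m τ s = ∫ l in Set.Icc a τ, Real.exp (-2 * gam d rstar s * (τ - l)) *
        (2 * b s ^ 2 + ε * Kwk d (m l) s) ↔
      U τ s = ∫ l in a..τ, Real.exp (-2 * gam d rstar s * (τ - l)) *
        (2 * β s + ε * G (U l) s) := by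
  have e : ∫ l in Set.Icc a τ, Real.exp (-2 * gam d rstar s * (τ - l)) *
      (2 * b s ^ 2 + ε * Kwk d (m l) s) = decay r s *
      ∫ l in a..τ, Real.exp (-2 * gam d rstar s * (τ - l)) * (2 * β s + ε * G (U l) s) := by
    rw [intervalIntegral.integral_of_le hτ, ← integral_Icc_eq_integral_Ioc, ← integral_const_mul]
    refine setIntegral_congr_fun measurableSet_Icc fun l hl => ?_
    simp only [← hU l hl.1, ← hG, ← congrFun hβ s, unweight]
    ring
  rw [e, ← hU τ hτ, unweight]
  exact mul_right_inj' (decay_pos r s).ne'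

end WeightedSpace

/-- For `d ≥ 2`, `r > d` there exist `ε_* > 0` and `C > 0`, independent of
`ε` and `T`, such that for every `ε ∈ [0, ε_*]` and `T ∈ (0,∞)` the solution `m*` of the
damped/driven wave kinetic equation with zero data at `τ = −T` exists and satisfies
`sup_{τ≥−T} ‖m*(τ) − m*⁰(τ)‖_r ≤ C ε`. -/
theorem statement8 (d : ℕ) (hd : 2 ≤ d) (r : ℝ) (hr : (d : ℝ) < r)
    (rstar : ℝ) (hrstar : 0 < rstar)
    (b : SchwartzMap (Rd d) ℝ) (hb : ∀ s, 0 < b s) :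
    ∃ εstar : ℝ, 0 < εstar ∧ ∃ C : ℝ, 0 < C ∧
      ∀ ε ∈ Set.Icc (0 : ℝ) εstar, ∀ T : ℝ, 0 < T →
        (∃ m : ℝ → Rd d → ℝ, IsWKESol d r rstar (⇑b) T ε m) ∧
        (∀ m : ℝ → Rd d → ℝ, IsWKESol d r rstar (⇑b) T ε m →
          ∀ τ ∈ Set.Ici (-T),
            wNorm d r (fun s => m τ s - linSol d rstar (⇑b) T τ s) ≤ C * ε) := by
  obtain ⟨L, G, hL, hG0, hGL, hG⟩ := exists_weighted_Kwk hd hr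
  obtain ⟨β, hβ⟩ := (SchwartzMap.memCr_sq (r := r) b).exists_unweight_eq
  have hg1 := one_le_gam (d := d) hrstar.le
  set A := ‖β‖ + 1
  have hA0 : 0 < A := by positivity
  refine ⟨1 / (2 * (L * (2 * A) ^ 2)), by positivity, L * (2 * A) ^ 2 * (2 * A) / 2,
    by positivity, fun ε hε T hT => ?_⟩
  have hεL : ε * (L * (2 * A) ^ 2) ≤ 1 / 2 := by
    have hP : 0 < L * (2 * A) ^ 2 := by positivity
    refine (mul_le_mul_of_nonneg_right hε.2 hP.le).trans_eq ?_
    field_simp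
  have hβA : ‖β‖ ≤ A := by linarith
  refine ⟨?_, fun m hm => ?_⟩
  · obtain ⟨u, hu⟩ := exists_duhamel_fixedPoint (continuous_gam d rstar) hg1 (-T) hL.le hG0 hGL
      hA0.le hβA hε.1 hεL
    refine ⟨fun τ => unweight r (u τ), fun τ _ => memCr_unweight r _,
      ⟨‖u‖, fun τ _ => by rw [wNorm_unweight]; exact u.norm_coe_le_norm τ⟩,
      fun τ₀ _ δ hδ => ?_, fun τ hτ s => ?_⟩
    · obtain ⟨η, hη, h⟩ := Metric.continuous_iff.1 u.continuous τ₀ δ hδ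
      refine ⟨η, hη, fun τ _ hτ => ?_⟩
      simp only [← unweight_sub]
      rw [wNorm_unweight, ← dist_eq_norm]
      exact h τ hτ
    · refine (unweight_duhamel_iff hβ hG hτ (U := u) (fun _ _ => rfl) s).2 ?_
      have hτ' : -T ≤ τ := hτ
      simpa only [max_eq_left hτ'] using hu τ s
  · obtain ⟨hmem, -, hcont, hsol⟩ := hm
    have hex (τ : ℝ) : ∃ u, -T ≤ τ → unweight r u = m τ := by
      by_cases h : -T ≤ τ
      · obtain ⟨u, hu⟩ := (hmem τ h).exists_unweight_eq
        exact ⟨u, fun _ => hu⟩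
      · exact ⟨0, fun h' => absurd h' h⟩
    choose U hU using hex
    have hUc : ContinuousOn U (Set.Ici (-T)) := by
      refine Metric.continuousOn_iff.2 fun τ₀ hτ₀ δ hδ => ?_
      obtain ⟨η, hη, h⟩ := hcont τ₀ hτ₀ δ hδ
      refine ⟨η, hη, fun τ hτ hd => ?_⟩
      have := h τ hτ hd
      rw [← hU τ hτ, ← hU τ₀ hτ₀] at this
      simp only [← unweight_sub] at this
      rwa [wNorm_unweight, ← dist_eq_norm] at this
    have hUsol (τ : ℝ) (hτ : -T ≤ τ) (s : Rd d) :=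
      (unweight_duhamel_iff hβ hG hτ hU s).1 (hsol τ hτ s)
    intro τ hτ
    refine ciSup_le fun s => ?_
    have h := abs_sub_linear_le_of_norm_le hg1 hL.le hG0 hGL hε.1 (by positivity) hUc hτ
      (hUsol τ hτ s) fun l hl => norm_le_of_duhamel hg1 hL.le hG0 hGL hA0 hβA hε.1 hεL hUc hUsol hl.1
    have e : m τ s - linSol d rstar b T τ s = decay r s * (U τ s - β s / gam d rstar s *
        (1 - Real.exp (-2 * gam d rstar s * (τ - -T)))) := by
      rw [← hU τ hτ, linSol, ← congrFun hβ s, unweight, unweight, sub_neg_eq_add]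
      ring
    change (1 + ‖s‖) ^ r * |m τ s - linSol d rstar b T τ s| ≤ _
    rw [e, abs_mul, abs_of_nonneg (decay_nonneg r s), ← mul_assoc, weight_mul_decay, one_mul]
    linarith
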